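/- Let m be a positive definite diagonal matrix in Sym_h(ℤ)∨ and φ a weakly holomorphic Jacobi form of weight k and index m. Then for α, β ∈ ℚ^h with 0 ≤ α_i ≤ 1 for all i, one has ord(φ[α,β]) ≥ ord(φ) − Σ_{i=1}^h m_ii·α_i(1−α_i). -/

import Mathlib

noncomputable section
open Matrix Complex
open scoped Manifold MatrixGroups

abbrev SL2Z := Matrix.SpecialLinearGroup (Fin 2) ℤ
abbrev UHP := UpperHalfPlane

/-- `e(x) = exp(2 π i x)`. -/
def eC (x : ℂ) : ℂ := Complex.exp (2 * Real.pi * Complex.I * x)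

/-- Coerce a rational matrix to a complex one. -/
def mC {h : ℕ} (m : Matrix (Fin h) (Fin h) ℚ) : Matrix (Fin h) (Fin h) ℂ :=
  m.map fun a => (a : ℂ)

def intVec {h : ℕ} (v : Fin h → ℤ) : Fin h → ℂ := fun i => (v i : ℂ)
def ratVec {h : ℕ} (v : Fin h → ℚ) : Fin h → ℂ := fun i => (v i : ℂ)

/-- `m ∈ Sym_h(ℤ)∨`: symmetric with integral diagonal and half-integral
off-diagonal entries. -/
def IsJacobiIndex {h : ℕ} (m : Matrix (Fin h) (Fin h) ℚ) : Prop :=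
  m.IsSymm ∧ (∀ i, ∃ n : ℤ, m i i = n) ∧ ∀ i j, ∃ n : ℤ, 2 * m i j = n

/-- weight-`k` index-`m` Jacobi slash action of `SL(2,ℤ)`. -/
def jslashSL {h : ℕ} (k : ℤ) (m : Matrix (Fin h) (Fin h) ℚ)
    (φ : UHP → (Fin h → ℂ) → ℂ) (γ : SL2Z) : UHP → (Fin h → ℂ) → ℂ := fun τ z =>
  let c : ℂ := ((γ 1 0 : ℤ) : ℂ)
  let d : ℂ := ((γ 1 1 : ℤ) : ℂ)
  (c * (τ : ℂ) + d) ^ (-k) * eC (-(c * (z ⬝ᵥ mC m *ᵥ z)) * (c * (τ : ℂ) + d)⁻¹) *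
    φ (γ • τ) ((c * (τ : ℂ) + d)⁻¹ • z)

/-- weight-`k` index-`m` Jacobi slash action of a (real) Heisenberg element
`(λ, μ, κ)`. -/
def jslashH {h : ℕ} (m : Matrix (Fin h) (Fin h) ℚ) (φ : UHP → (Fin h → ℂ) → ℂ)
    (lam mu : Fin h → ℂ) (kap : Matrix (Fin h) (Fin h) ℂ) : UHP → (Fin h → ℂ) → ℂ :=
  fun τ z =>
    eC ((lam ⬝ᵥ mC m *ᵥ lam) * (τ : ℂ) + 2 * (lam ⬝ᵥ mC m *ᵥ z)
        + (mC m * (kap + vecMulVec mu lam)).trace) * φ τ (z + (τ : ℂ) • lam + mu)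

/-- The block matrix `(2n, rᵀ; r, 2m)` over `ℝ`. -/
def bigMat {h : ℕ} (m : Matrix (Fin h) (Fin h) ℚ) (n : ℤ) (r : Fin h → ℤ) :
    Matrix (Unit ⊕ Fin h) (Unit ⊕ Fin h) ℝ :=
  Matrix.fromBlocks (Matrix.of fun _ _ => (2 * n : ℝ)) (Matrix.of fun _ j => (r j : ℝ))
    (Matrix.of fun i _ => (r i : ℝ)) ((2 : ℝ) • m.map fun a => (a : ℝ))

/-- A weakly holomorphic Jacobi form of genus 1, cogenus `h`, weight `k` and
index `m`, bundled with its Fourier coefficients. -/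
structure WeakJacobiForm (h : ℕ) (k : ℤ) (m : Matrix (Fin h) (Fin h) ℚ) where
  toFun : UHP → (Fin h → ℂ) → ℂ
  holo_tau : ∀ z, MDifferentiable 𝓘(ℂ) 𝓘(ℂ) fun τ : UHP => toFun τ z
  holo_z : ∀ τ, Differentiable ℂ fun z => toFun τ z
  inv_sl : ∀ γ : SL2Z, jslashSL k m toFun γ = toFun
  inv_heis : ∀ (lam mu : Fin h → ℤ) (kap : Matrix (Fin h) (Fin h) ℤ),
    ((kap.map fun a => (a : ℚ)) +
      vecMulVec (fun i => (mu i : ℚ)) fun i => (lam i : ℚ)).IsSymm →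
    jslashH m toFun (intVec lam) (intVec mu) (kap.map fun a => (a : ℂ)) = toFun
  coeff : ℤ → (Fin h → ℤ) → ℂ
  expansion : ∀ τ z, toFun τ z =
    ∑' p : ℤ × (Fin h → ℤ), coeff p.1 p.2 * eC ((p.1 : ℂ) * (τ : ℂ) + intVec p.2 ⬝ᵥ z)
  bdd_below : ∃ n₀ : ℤ, ∀ n r, n < n₀ → coeff n r = 0

/-- The Fourier support condition singling out holomorphic Jacobi forms among
weakly holomorphic ones. -/
def WeakJacobiForm.IsHolomorphicJF {h : ℕ} {k : ℤ} {m : Matrix (Fin h) (Fin h) ℚ}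
    (φ : WeakJacobiForm h k m) : Prop :=
  ∀ n r, ¬ (bigMat m n r).PosSemidef → φ.coeff n r = 0

/-- Specialization `φ[α,β]` of a Jacobi form to the torsion point `z = ατ + β`. -/
def torsionSpec {h : ℕ} (m : Matrix (Fin h) (Fin h) ℚ) (φ : UHP → (Fin h → ℂ) → ℂ)
    (α β : Fin h → ℚ) : UHP → ℂ :=
  fun τ => jslashH m φ (ratVec α) (ratVec β) (vecMulVec (ratVec α) (ratVec β)) τ 0

/-- `OrdGE f c` formalizes that the vanishing order of `f` at `i∞` is at least
`c`: the function `f(τ) e(-cτ)` is bounded on `im τ ≥ 1`. -/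
def OrdGE (f : UHP → ℂ) (c : ℝ) : Prop :=
  ∃ C : ℝ, ∀ τ : UHP, 1 ≤ τ.im → ‖f τ * Complex.exp (-(2 * Real.pi * Complex.I * c * (τ : ℂ)))‖ ≤ C

/-- The weight-`k` slash action on functions on the upper half plane. -/
def eslash (k : ℤ) (f : UHP → ℂ) (γ : SL2Z) : UHP → ℂ := fun τ =>
  (((γ 1 0 : ℤ) : ℂ) * (τ : ℂ) + ((γ 1 1 : ℤ) : ℂ)) ^ (-k) * f (γ • τ)


def nt {h : ℕ} (c : ℤ → (Fin h → ℤ) → ℂ) (v : ℝ) (y : Fin h → ℝ) (p : ℤ × (Fin h → ℤ)) : ℝ :=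
  ‖c p.1 p.2‖ * Real.exp (-(2 * Real.pi * (p.1 * v + ∑ i, (p.2 i : ℝ) * y i)))

lemma nt_nonneg {h : ℕ} (c : ℤ → (Fin h → ℤ) → ℂ) (v : ℝ) (y : Fin h → ℝ)
    (p : ℤ × (Fin h → ℤ)) : 0 ≤ nt c v y p := by unfold nt; positivity

lemma norm_eC (x : ℂ) : ‖eC x‖ = Real.exp (-(2 * Real.pi * x.im)) := by
  unfold eC
  rw [Complex.norm_exp]
  congr 1
  simp

lemma norm_term {h : ℕ} (c : ℤ → (Fin h → ℤ) → ℂ) (τ : ℂ) (z : Fin h → ℂ)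
    (p : ℤ × (Fin h → ℤ)) :
    ‖c p.1 p.2 * eC ((p.1 : ℂ) * τ + intVec p.2 ⬝ᵥ z)‖ = nt c τ.im (fun i => (z i).im) p := by
  rw [norm_mul, norm_eC, nt]
  congr 4
  simp [dotProduct, intVec]

lemma summable_term {h : ℕ} (c : ℤ → (Fin h → ℤ) → ℂ) (τ : ℂ) (z : Fin h → ℂ) :
    Summable (fun p : ℤ × (Fin h → ℤ) => c p.1 p.2 * eC ((p.1 : ℂ) * τ + intVec p.2 ⬝ᵥ z)) ↔
      Summable (nt c τ.im (fun i => (z i).im)) := by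
  rw [← summable_norm_iff]
  simp_rw [norm_term]

lemma nt_mid {h : ℕ} (c : ℤ → (Fin h → ℤ) → ℂ) (v : ℝ) (y d : Fin h → ℝ) (s t : ℝ)
    (hs : 0 ≤ s) (ht : 0 ≤ t)
    (h1 : Summable (nt c v (y + s • d))) (h2 : Summable (nt c v (y - t • d))) :
    Summable (nt c v y) := by
  refine Summable.of_nonneg_of_le (nt_nonneg c v y) (fun p => ?_) (h1.add h2)
  have e1 : ∑ i, (p.2 i : ℝ) * (y + s • d) i = ∑ i, (p.2 i : ℝ) * y i + s * ∑ i, (p.2 i : ℝ) * d i := by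
    rw [Finset.mul_sum, ← Finset.sum_add_distrib]
    refine Finset.sum_congr rfl fun i _ => ?_
    simp; ring
  have e2 : ∑ i, (p.2 i : ℝ) * (y - t • d) i = ∑ i, (p.2 i : ℝ) * y i - t * ∑ i, (p.2 i : ℝ) * d i := by
    rw [Finset.mul_sum, ← Finset.sum_sub_distrib]
    refine Finset.sum_congr rfl fun i _ => ?_
    simp; ring
  rcases le_total (∑ i, (p.2 i : ℝ) * d i) 0 with hd | hd
  · refine le_trans ?_ (le_add_of_nonneg_right (nt_nonneg _ _ _ _))
    unfold nt
    rw [e1]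
    have := mul_nonpos_of_nonneg_of_nonpos hs hd
    gcongr
    linarith
  · refine le_trans ?_ (le_add_of_nonneg_left (nt_nonneg _ _ _ _))
    unfold nt
    rw [e2]
    have := mul_nonneg ht hd
    gcongr
    linarith

lemma nt_mono {h : ℕ} (c : ℤ → (Fin h → ℤ) → ℂ) (n₀ : ℤ) (hc : ∀ n r, n < n₀ → c n r = 0)
    (v v' : ℝ) (hv : v ≤ v') (y : Fin h → ℝ) (h1 : Summable (nt c v y)) :
    Summable (nt c v' y) := by
  refine Summable.of_nonneg_of_le (nt_nonneg c v' y) (fun p => ?_)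
    (h1.mul_left (Real.exp (-(2 * Real.pi * (n₀ * (v' - v))))))
  by_cases hp : p.1 < n₀
  · simp [nt, hc _ _ hp]
  · unfold nt
    rw [mul_left_comm, ← Real.exp_add]
    have : (n₀ : ℝ) ≤ p.1 := by exact_mod_cast not_lt.mp hp
    have h2 : (n₀ : ℝ) * (v' - v) ≤ p.1 * (v' - v) := mul_le_mul_of_nonneg_right this (by linarith)
    have h3 := mul_le_mul_of_nonneg_left h2 (by positivity : 0 ≤ 2 * Real.pi)
    gcongr
    linarith

/-- An entire function vanishing on an open half plane vanishes. -/
lemma entire_zero (g : ℂ → ℂ) (hg : Differentiable ℂ g) (w₀ : ℂ) (U : Set ℂ) (hU : IsOpen U)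
    (hw : w₀ ∈ U) (hz : ∀ w ∈ U, g w = 0) (w : ℂ) : g w = 0 := by
  have ha : AnalyticOnNhd ℂ g Set.univ := hg.differentiableOn.analyticOnNhd isOpen_univ
  exact ha.eqOn_zero_of_preconnected_of_eventuallyEq_zero isPreconnected_univ (Set.mem_univ w₀)
    (Filter.eventually_of_mem (hU.mem_nhds hw) hz) (Set.mem_univ w)

lemma zero_of_not_summable {h : ℕ} {k : ℤ} {m : Matrix (Fin h) (Fin h) ℚ}
    (φ : WeakJacobiForm h k m) (τ : UHP) (y : Fin h → ℝ)
    (hns : ¬ Summable (nt φ.coeff τ.im y)) (z : Fin h → ℂ) : φ.toFun τ z = 0 := by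
  have key : ∀ z : Fin h → ℂ, ¬ Summable (nt φ.coeff τ.im (fun i => (z i).im)) →
      φ.toFun τ z = 0 := by
    intro z hz
    rw [φ.expansion]
    apply tsum_eq_zero_of_not_summable
    rw [summable_term]
    exact hz
  set d : Fin h → ℝ := fun i => (z i).im - y i with hd
  set z0 : Fin h → ℂ := fun i => ((z i).re : ℂ) + (y i : ℂ) * I with hz0
  set g : ℂ → ℂ := fun w => φ.toFun τ (z0 + w • (fun i => (d i : ℂ))) with hg
  have him : ∀ w : ℂ, (fun i => ((z0 + w • (fun i => (d i : ℂ))) i).im) = y + w.im • d := by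
    intro w
    ext i
    simp [hz0]
  have hgd : Differentiable ℂ g := by
    refine (φ.holo_z τ).comp ?_
    fun_prop
  have hgI : g I = φ.toFun τ z := by
    simp only [hg]
    congr 1
    ext i
    apply Complex.ext <;> simp [hz0, hd]
  rw [← hgI]
  by_cases hup : ∃ s : ℝ, 0 ≤ s ∧ Summable (nt φ.coeff τ.im (y + s • d))
  · obtain ⟨s, hs, hs'⟩ := hup
    refine entire_zero g hgd (-I) {w | w.im < 0} (isOpen_lt Complex.continuous_im continuous_const)
      (by simp) (fun w hw => key _ fun hsum => hns ?_) I
    rw [him] at hsum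
    refine nt_mid _ _ y d s (-w.im) hs (by simp at hw; linarith) hs' ?_
    simpa using hsum
  · push Not at hup
    refine entire_zero g hgd I {w | 0 < w.im} (isOpen_lt continuous_const Complex.continuous_im)
      (by simp) (fun w hw => key _ fun hsum => ?_) I
    rw [him] at hsum
    exact hup _ (le_of_lt hw) hsum

lemma zero_or_summable {h : ℕ} {k : ℤ} {m : Matrix (Fin h) (Fin h) ℚ}
    (φ : WeakJacobiForm h k m) :
    (∀ τ z, φ.toFun τ z = 0) ∨ ∀ v : ℝ, 0 < v → ∀ y, Summable (nt φ.coeff v y) := by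
  by_contra! hcon
  obtain ⟨⟨τ, z, hτ⟩, v, hv, y, hns⟩ := hcon
  apply hτ
  obtain ⟨n₀, hn₀⟩ := φ.bdd_below
  have hz : ∀ σ : UHP, σ.im ≤ v → φ.toFun σ z = 0 := fun σ hσ =>
    zero_of_not_summable φ σ y (fun hs => hns (nt_mono _ n₀ hn₀ _ _ hσ y hs)) z
  have hd := UpperHalfPlane.mdifferentiable_iff.mp (φ.holo_tau z)
  have ha := hd.analyticOnNhd UpperHalfPlane.isOpen_upperHalfPlaneSet
  have hw : (((v / 2 : ℝ) : ℂ) * I) ∈ UpperHalfPlane.upperHalfPlaneSet := by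
    simp [UpperHalfPlane.upperHalfPlaneSet, hv]
  have hw2 : (((v / 2 : ℝ) : ℂ) * I) ∈ {w : ℂ | w.im < v} := by
    simp [hv]
  have hev : ((fun τ : UHP => φ.toFun τ z) ∘ UpperHalfPlane.ofComplex)
      =ᶠ[nhds (((v / 2 : ℝ) : ℂ) * I)] 0 := by
    filter_upwards [(isOpen_lt Complex.continuous_im continuous_const).mem_nhds hw2,
      UpperHalfPlane.isOpen_upperHalfPlaneSet.mem_nhds hw] with w h1 h2
    simp only [Function.comp]
    apply hz
    rw [UpperHalfPlane.ofComplex_apply_of_im_pos h2]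
    exact le_of_lt h1
  have hpc : IsPreconnected UpperHalfPlane.upperHalfPlaneSet :=
    (convex_halfSpace_im_gt 0).isPreconnected
  have := ha.eqOn_zero_of_preconnected_of_eventuallyEq_zero hpc hw hev
    (show (τ : ℂ) ∈ UpperHalfPlane.upperHalfPlaneSet from τ.im_pos)
  simpa using this

def idx {h : ℕ} (p : ℤ × (Fin h → ℤ)) : Option (Fin h) → ℤ := fun o => o.elim p.1 p.2

lemma idx_inj {h : ℕ} : Function.Injective (idx (h := h)) := by
  intro p q hpq
  refine Prod.ext (congrFun hpq none) (funext fun i => congrFun hpq (some i))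

/-- Uniqueness of Fourier coefficients. -/
lemma fourier_unique {h : ℕ} (D : ℤ × (Fin h → ℤ) → ℂ) (hs : Summable D)
    (hz : ∀ (x : ℝ) (y : Fin h → ℝ),
      ∑' p, D p * eC ((p.1 : ℂ) * x + intVec p.2 ⬝ᵥ (fun i => (y i : ℂ))) = 0) (p) : D p = 0 := by
  have h1 : Summable fun p => D p • UnitAddTorus.mFourier (idx p) := by
    refine Summable.of_norm ?_
    simp_rw [norm_smul, UnitAddTorus.mFourier_norm, mul_one]
    exact hs.norm
  have h2 : HasSum (fun p => D p • UnitAddTorus.mFourier (idx p)) 0 := by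
    convert h1.hasSum
    ext t
    rw [← ContinuousMap.tsum_apply h1]
    obtain ⟨x, rfl⟩ : ∃ x : Option (Fin h) → ℝ, t = fun i => (x i : UnitAddCircle) := by
      choose x hx using fun i => QuotientAddGroup.mk_surjective (t i)
      exact ⟨x, funext fun i => (hx i).symm⟩
    rw [ContinuousMap.zero_apply, ← hz (x none) (fun i => x (some i))]
    refine tsum_congr fun q => ?_
    simp only [ContinuousMap.smul_apply, smul_eq_mul]
    congr 1
    simp only [UnitAddTorus.mFourier, ContinuousMap.coe_mk, fourier_coe_apply, eC]
    rw [← Complex.exp_sum, Fintype.sum_option]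
    congr 1
    simp only [idx, Option.elim, intVec, dotProduct, mul_add, Finset.mul_sum]
    congr 1
    · push_cast; ring
    · refine Finset.sum_congr rfl fun i _ => ?_
      push_cast; ring
  let _ : MeasureTheory.MeasureSpace UnitAddCircle := ⟨AddCircle.haarAddCircle⟩
  have : MeasureTheory.IsProbabilityMeasure (MeasureTheory.volume : MeasureTheory.Measure UnitAddCircle) :=
    inferInstanceAs (MeasureTheory.IsProbabilityMeasure AddCircle.haarAddCircle)
  let T := (ContinuousMap.toLp (E := ℂ) 2
    (MeasureTheory.volume : MeasureTheory.Measure (UnitAddTorus (Option (Fin h)))) ℂ)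
  let S := innerSL ℂ (UnitAddTorus.mFourierLp (d := Option (Fin h)) 2 (idx p))
  have h4 := h2.mapL (S.comp T)
  have hST : ∀ q, (S.comp T) (D q • UnitAddTorus.mFourier (idx q)) = if q = p then D p else 0 := by
    intro q
    have ho : S (T (UnitAddTorus.mFourier (idx q))) = if idx p = idx q then (1 : ℂ) else 0 :=
      orthonormal_iff_ite.mp (UnitAddTorus.orthonormal_mFourier (d := Option (Fin h)))
        (idx p) (idx q)
    rw [map_smul, ContinuousLinearMap.comp_apply, ho]
    by_cases hq : q = p
    · simp [hq]
    · have : idx p ≠ idx q := fun e => hq (idx_inj e).symm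
      simp [hq, this]
  have h5 : HasSum (fun q => if q = p then D p else 0) 0 := by
    have h6 : (S.comp T) 0 = 0 := map_zero _
    rw [h6] at h4
    rwa [funext hST] at h4
  exact (hasSum_ite_eq p (D p)).unique h5

lemma quad {h : ℕ} (m : Matrix (Fin h) (Fin h) ℚ) (M : Fin h → ℤ) (hM : ∀ i, m i i = M i)
    (hdiag : ∀ i j : Fin h, i ≠ j → m i j = 0) (u w : Fin h → ℂ) :
    u ⬝ᵥ mC m *ᵥ w = ∑ i, (M i : ℂ) * u i * w i := by
  have : mC m = Matrix.diagonal fun i => (M i : ℂ) := by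
    ext i j
    by_cases hij : i = j
    · subst hij; simp [mC, hM]
    · simp [mC, hdiag i j hij, hij]
  rw [this, dotProduct]
  refine Finset.sum_congr rfl fun i _ => ?_
  rw [Matrix.mulVec_diagonal]
  ring

/-- The translation on Fourier indices induced by `lam`. -/
def shift {h : ℕ} (M lam : Fin h → ℤ) : ℤ × (Fin h → ℤ) ≃ ℤ × (Fin h → ℤ) where
  toFun p := (p.1 + ∑ i, (p.2 i * lam i + M i * lam i * lam i), fun i => p.2 i + 2 * M i * lam i)
  invFun p := (p.1 - ∑ i, (p.2 i * lam i - M i * lam i * lam i), fun i => p.2 i - 2 * M i * lam i)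
  left_inv p := by
    refine Prod.ext ?_ (funext fun i => by simp)
    simp only
    rw [add_sub_assoc, ← Finset.sum_sub_distrib, add_eq_left]
    exact Finset.sum_eq_zero fun i _ => by ring
  right_inv p := by
    refine Prod.ext ?_ (funext fun i => by simp)
    simp only
    rw [sub_add, ← Finset.sum_sub_distrib, sub_eq_self]
    exact Finset.sum_eq_zero fun i _ => by ring

lemma eC_add (x y : ℂ) : eC (x + y) = eC x * eC y := by
  unfold eC
  rw [mul_add, Complex.exp_add]

lemma coeff_shift {h : ℕ} {k : ℤ} {m : Matrix (Fin h) (Fin h) ℚ}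
    (M : Fin h → ℤ) (hM : ∀ i, m i i = M i) (hdiag : ∀ i j : Fin h, i ≠ j → m i j = 0)
    (φ : WeakJacobiForm h k m) (hs : ∀ v : ℝ, 0 < v → ∀ y, Summable (nt φ.coeff v y))
    (lam : Fin h → ℤ) (p : ℤ × (Fin h → ℤ)) :
    φ.coeff (shift M lam p).1 (shift M lam p).2 = φ.coeff p.1 p.2 := by
  have hS : ∀ (τ : UHP) (z : Fin h → ℂ), Summable (fun p : ℤ × (Fin h → ℤ) =>
      φ.coeff p.1 p.2 * eC ((p.1 : ℂ) * (τ : ℂ) + intVec p.2 ⬝ᵥ z)) := fun τ z =>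
    (summable_term _ _ _).mpr (hs _ τ.im_pos _)
  have hterm : ∀ (τ : UHP) (z : Fin h → ℂ) (p : ℤ × (Fin h → ℤ)),
      eC ((intVec lam ⬝ᵥ mC m *ᵥ intVec lam) * (τ : ℂ) + 2 * (intVec lam ⬝ᵥ mC m *ᵥ z)) *
        (φ.coeff p.1 p.2 *
          eC ((p.1 : ℂ) * (τ : ℂ) + intVec p.2 ⬝ᵥ (z + (τ : ℂ) • intVec lam))) =
      φ.coeff p.1 p.2 *
        eC (((shift M lam p).1 : ℂ) * (τ : ℂ) + intVec (shift M lam p).2 ⬝ᵥ z) := by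
    intro τ z p
    rw [mul_left_comm, ← eC_add, quad m M hM hdiag, quad m M hM hdiag]
    congr 2
    simp only [shift, Equiv.coe_fn_mk, dotProduct, intVec, Pi.add_apply, Pi.smul_apply, smul_eq_mul]
    push_cast
    simp only [add_mul, mul_add, Finset.sum_add_distrib, Finset.mul_sum, Finset.sum_mul]
    have e1 : ∀ x : Fin h, (p.2 x : ℂ) * ((τ : ℂ) * (lam x : ℂ)) = p.2 x * lam x * τ :=
      fun x => by ring
    have e2 : ∀ x : Fin h, 2 * ((M x : ℂ) * (lam x : ℂ) * z x) = 2 * M x * lam x * z x :=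
      fun x => by ring
    simp only [e1, e2]
    ring
  have hinv : ∀ (τ : UHP) (z : Fin h → ℂ),
      ∑' p : ℤ × (Fin h → ℤ), φ.coeff p.1 p.2 *
        eC (((shift M lam p).1 : ℂ) * (τ : ℂ) + intVec (shift M lam p).2 ⬝ᵥ z) = φ.toFun τ z := by
    intro τ z
    have h0 := congrFun (congrFun (φ.inv_heis lam 0 0 (by
      ext i j; simp [vecMulVec])) τ) z
    rw [← h0]
    simp_rw [← hterm]
    rw [tsum_mul_left, jslashH, φ.expansion]
    have e1 : intVec (0 : Fin h → ℤ) = 0 := by ext i; simp [intVec]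
    have e2 : ((0 : Matrix (Fin h) (Fin h) ℤ).map fun a => (a : ℂ)) = 0 := by ext i j; simp
    rw [e1, e2]
    simp
  have hsumm : ∀ (τ : UHP) (z : Fin h → ℂ), Summable (fun p : ℤ × (Fin h → ℤ) => φ.coeff p.1 p.2 *
        eC (((shift M lam p).1 : ℂ) * (τ : ℂ) + intVec (shift M lam p).2 ⬝ᵥ z)) := by
    intro τ z
    simp_rw [← hterm]
    exact (hS _ _).mul_left _
  set E := shift M lam with hE
  -- reindexed version
  have hsumm2 : ∀ (τ : UHP) (z : Fin h → ℂ), Summable (fun q : ℤ × (Fin h → ℤ) =>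
      φ.coeff (E.symm q).1 (E.symm q).2 * eC ((q.1 : ℂ) * (τ : ℂ) + intVec q.2 ⬝ᵥ z)) := by
    intro τ z
    rw [← E.summable_iff]
    refine (hsumm τ z).congr fun p => ?_
    simp
  have hinv2 : ∀ (τ : UHP) (z : Fin h → ℂ), ∑' q : ℤ × (Fin h → ℤ),
      φ.coeff (E.symm q).1 (E.symm q).2 * eC ((q.1 : ℂ) * (τ : ℂ) + intVec q.2 ⬝ᵥ z)
        = φ.toFun τ z := by
    intro τ z
    rw [← hinv, ← E.tsum_eq]
    refine tsum_congr fun p => ?_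
    simp
  set D : ℤ × (Fin h → ℤ) → ℂ := fun q =>
    (φ.coeff q.1 q.2 - φ.coeff (E.symm q).1 (E.symm q).2) * eC ((q.1 : ℂ) * I) with hD
  have hDsum : Summable D := by
    refine ((hS UpperHalfPlane.I 0).sub (hsumm2 UpperHalfPlane.I 0)).congr fun q => ?_
    simp [hD, sub_mul]
  have hDz := fourier_unique D hDsum (fun x y => by
    let τ : UHP := ⟨(x : ℂ) + I, by simp⟩
    have hτ : (τ : ℂ) = (x : ℂ) + I := rfl
    let z : Fin h → ℂ := fun i => (y i : ℂ)
    have h1 := (hS τ z).tsum_sub (hsumm2 τ z)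
    rw [hinv2, ← φ.expansion, sub_self] at h1
    rw [← h1]
    refine tsum_congr fun q => ?_
    rw [hD, hτ, ← sub_mul]
    simp only []
    rw [mul_assoc, ← eC_add]
    congr 2
    ring) (E p)
  rw [hD] at hDz
  simp only [Equiv.symm_apply_apply] at hDz
  have hne : eC (((E p).1 : ℂ) * I) ≠ 0 := Complex.exp_ne_zero _
  exact sub_eq_zero.mp ((mul_eq_zero.mp hDz).resolve_right hne)

lemma coeff_bound {h : ℕ} {k : ℤ} {m : Matrix (Fin h) (Fin h) ℚ}
    (M : Fin h → ℤ) (hM : ∀ i, m i i = M i) (hdiag : ∀ i j : Fin h, i ≠ j → m i j = 0)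
    (φ : WeakJacobiForm h k m) (hs : ∀ v : ℝ, 0 < v → ∀ y, Summable (nt φ.coeff v y))
    (ν : ℤ) (hν : ∀ n r, n < ν → φ.coeff n r = 0) (a : Fin h → ℝ)
    (ha : ∀ i, 0 ≤ a i ∧ a i ≤ 1) (p : ℤ × (Fin h → ℤ)) (hp : φ.coeff p.1 p.2 ≠ 0) :
    (ν : ℝ) ≤ p.1 + ∑ i, ((p.2 i : ℝ) + M i) * a i := by
  set lam : Fin h → ℤ := fun i => if p.2 i + M i < 0 then 1 else 0 with hlam
  rw [← coeff_shift M hM hdiag φ hs lam p] at hp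
  have h1 : ν ≤ (shift M lam p).1 := by
    by_contra! hlt
    exact hp (hν _ _ hlt)
  have h2 : (ν : ℝ) ≤ ((shift M lam p).1 : ℤ) := by exact_mod_cast h1
  refine h2.trans ?_
  simp only [shift, Equiv.coe_fn_mk]
  push_cast
  gcongr with i _
  obtain ⟨h0, h1⟩ := ha i
  by_cases hi : p.2 i + M i < 0
  · have hr : (p.2 i : ℝ) + M i < 0 := by exact_mod_cast hi
    simp only [hlam, hi, if_true]
    push_cast
    nlinarith
  · have hr : 0 ≤ (p.2 i : ℝ) + M i := by exact_mod_cast not_lt.mp hi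
    simp only [hlam, hi, if_false]
    push_cast
    nlinarith

/-- For a weakly holomorphic Jacobi form of positive definite diagonal index
`m` and `α, β ∈ ℚ^h` with entries in `[0,1]`, one has
`ord(φ[α,β]) ≥ ord(φ) − Σᵢ mᵢᵢ αᵢ(1−αᵢ)`. -/
theorem stmt16 (h : ℕ) (k : ℤ) (m : Matrix (Fin h) (Fin h) ℚ)
    (hm : IsJacobiIndex m) (hdiag : ∀ i j : Fin h, i ≠ j → m i j = 0)
    (hpd : (m.map fun a => (a : ℝ)).PosDef)
    (φ : WeakJacobiForm h k m) (α β : Fin h → ℚ)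
    (hα : ∀ i, 0 ≤ α i ∧ α i ≤ 1) (hβ : ∀ i, 0 ≤ β i ∧ β i ≤ 1)
    (ν : ℤ) (hν : ∀ n r, n < ν → φ.coeff n r = 0) :
    OrdGE (torsionSpec m φ.toFun α β)
      ((ν : ℝ) - ∑ i, (m i i : ℝ) * (α i : ℝ) * (1 - (α i : ℝ))) := by
  choose M hM using hm.2.1
  rcases zero_or_summable φ with h0 | hs
  · refine ⟨0, fun τ _ => ?_⟩
    simp [torsionSpec, jslashH, h0]
  set a : Fin h → ℝ := fun i => (α i : ℝ) with ha
  have ha01 : ∀ i, 0 ≤ a i ∧ a i ≤ 1 := fun i =>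
    ⟨by simp only [ha]; exact_mod_cast (hα i).1, by simp only [ha]; exact_mod_cast (hα i).2⟩
  have hb := coeff_bound M hM hdiag φ hs ν hν a ha01
  set c : ℝ := (ν : ℝ) - ∑ i, (m i i : ℝ) * (α i : ℝ) * (1 - (α i : ℝ)) with hc
  have hc' : c = ν - ∑ i, (M i : ℝ) * a i * (1 - a i) := by
    rw [hc]; congr 1
    refine Finset.sum_congr rfl fun i _ => ?_
    rw [hM i]; push_cast; rfl
  set Q : ℂ := ratVec α ⬝ᵥ mC m *ᵥ ratVec α with hQ
  have hQ' : Q = ((∑ i, (M i : ℝ) * a i * a i : ℝ) : ℂ) := by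
    rw [hQ, quad m M hM hdiag]
    push_cast
    refine Finset.sum_congr rfl fun i _ => ?_
    simp [ratVec, ha]
  set K : ℂ := (mC m * (vecMulVec (ratVec α) (ratVec β) + vecMulVec (ratVec β) (ratVec α))).trace
    with hK
  set q : ℝ := ∑ i, (M i : ℝ) * a i * a i with hq
  have hsum := hs 1 one_pos a
  refine ⟨‖eC K‖ * Real.exp (-(2 * Real.pi * (q - c))) * ∑' p, nt φ.coeff 1 a p, fun τ hτ => ?_⟩
  have hexp : Complex.exp (-(2 * Real.pi * Complex.I * c * (τ : ℂ))) = eC (-(c * (τ : ℂ))) := by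
    unfold eC; congr 1; ring
  set z : Fin h → ℂ := (0 : Fin h → ℂ) + (τ : ℂ) • ratVec α + ratVec β with hz
  have hzim : (fun i => (z i).im) = fun i => τ.im * a i := by
    ext i
    simp [hz, ratVec, ha]
  have hT : torsionSpec m φ.toFun α β τ = eC (Q * (τ : ℂ)) * eC K * φ.toFun τ z := by
    simp only [torsionSpec, jslashH]
    rw [← hQ, ← hK, ← hz, ← eC_add]
    simp
  have hφ : ‖φ.toFun τ z‖ ≤ ∑' p, nt φ.coeff τ.im (fun i => τ.im * a i) p := by
    have hsτ := hs τ.im τ.im_pos (fun i => τ.im * a i)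
    rw [φ.expansion]
    have hn : ∀ p : ℤ × (Fin h → ℤ), ‖φ.coeff p.1 p.2 * eC ((p.1 : ℂ) * (τ : ℂ) +
        intVec p.2 ⬝ᵥ z)‖ = nt φ.coeff τ.im (fun i => τ.im * a i) p := by
      intro p
      rw [norm_term, hzim]
      rfl
    refine tsum_of_norm_bounded hsτ.hasSum fun p => (hn p).le
  have h1 : ‖eC (Q * (τ : ℂ))‖ * ‖eC (-(c * (τ : ℂ)))‖ =
      Real.exp (-(2 * Real.pi * ((q - c) * τ.im))) := by
    rw [norm_eC, norm_eC, ← Real.exp_add, hQ']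
    congr 1
    simp
    ring
  rw [hexp, hT, norm_mul, norm_mul, norm_mul]
  calc ‖eC (Q * (τ : ℂ))‖ * ‖eC K‖ * ‖φ.toFun τ z‖ * ‖eC (-(c * (τ : ℂ)))‖
      = ‖eC K‖ * ((‖eC (Q * (τ : ℂ))‖ * ‖eC (-(c * (τ : ℂ)))‖) * ‖φ.toFun τ z‖) := by ring
    _ ≤ ‖eC K‖ * (Real.exp (-(2 * Real.pi * ((q - c) * τ.im))) *
          ∑' p, nt φ.coeff τ.im (fun i => τ.im * a i) p) := by
        rw [h1]; gcongr
    _ ≤ ‖eC K‖ * (Real.exp (-(2 * Real.pi * (q - c))) * ∑' p, nt φ.coeff 1 a p) := by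
        refine mul_le_mul_of_nonneg_left ?_ (norm_nonneg _)
        rw [← tsum_mul_left, ← tsum_mul_left]
        refine Summable.tsum_le_tsum (fun p => ?_)
          ((hs τ.im τ.im_pos (fun i => τ.im * a i)).mul_left _) (hsum.mul_left _)
        by_cases hp : φ.coeff p.1 p.2 = 0
        · simp [nt, hp]
        have hbp := hb p hp
        unfold nt
        rw [mul_left_comm, ← Real.exp_add, mul_left_comm (Real.exp _), ← Real.exp_add]
        have e1 : ∑ i, (p.2 i : ℝ) * (τ.im * a i) = τ.im * ∑ i, (p.2 i : ℝ) * a i := by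
          rw [Finset.mul_sum]
          exact Finset.sum_congr rfl fun i _ => by ring
        rw [e1]
        have e2 : ∑ i, ((p.2 i : ℝ) + M i) * a i =
            ∑ i, (p.2 i : ℝ) * a i + ∑ i, (M i : ℝ) * a i * (1 - a i) + q := by
          rw [hq, ← Finset.sum_add_distrib, ← Finset.sum_add_distrib]
          exact Finset.sum_congr rfl fun i _ => by ring
        rw [e2] at hbp
        have e3 : 0 ≤ q - c + p.1 + ∑ i, (p.2 i : ℝ) * a i := by rw [hc']; linarith
        have e4 := mul_nonneg (mul_nonneg Real.pi_pos.le e3) (sub_nonneg.mpr hτ)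
        refine mul_le_mul_of_nonneg_left (Real.exp_le_exp.mpr ?_) (norm_nonneg _)
        nlinarith
    _ = _ := by ring
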